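/- For a system of N harmonic oscillators with nonresonant frequencies ω₁,…,ω_N (no nontrivial integer relation Σ mᵢωᵢ = 0), the support function of the reachable set satisfies lim_{T→∞} (1/T) H_{D(T)}(p) = ∫_𝕋 |Σᵢ zᵢ cos φᵢ| dφ, where zᵢ = (ηᵢ² + ωᵢ⁻² ξᵢ²)^{1/2} and dφ is normalized Haar measure on the N-torus 𝕋. -/

import Mathlib

open MeasureTheory Real Filter

instance : Fact (0 < 2 * Real.pi) := ⟨by positivity⟩

open Topology Submodule

/-- If the time averages along a curve converge to the space average for a family of continuous
functions with dense span, then they do so for every continuous function. -/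
theorem tendsto_timeAverage_of_span_dense {X : Type*} [TopologicalSpace X] [CompactSpace X]
    [MeasurableSpace X] [OpensMeasurableSpace X] {μ : Measure X} [IsProbabilityMeasure μ]
    {γ : ℝ → X} (hγ : Continuous γ) {s : Set C(X, ℂ)} (hs : Dense (span ℂ s : Set C(X, ℂ)))
    (h : ∀ f ∈ s, Tendsto (fun T : ℝ => (T⁻¹ : ℂ) * ∫ t in (0 : ℝ)..T, f (γ t)) atTop
      (𝓝 (∫ x, f x ∂μ))) (f : C(X, ℂ)) :
    Tendsto (fun T : ℝ => (T⁻¹ : ℂ) * ∫ t in (0 : ℝ)..T, f (γ t)) atTop (𝓝 (∫ x, f x ∂μ)) := by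
  have hint (f : C(X, ℂ)) : Integrable f μ :=
    f.continuous.integrable_of_hasCompactSupport (HasCompactSupport.of_compactSpace _)
  have hγint (f : C(X, ℂ)) (T : ℝ) : IntervalIntegrable (fun t => f (γ t)) volume 0 T :=
    (f.continuous.comp hγ).intervalIntegrable _ _
  have hclosed : IsClosed {f : C(X, ℂ) | Tendsto (fun T : ℝ => (T⁻¹ : ℂ) * ∫ t in (0 : ℝ)..T,
      f (γ t)) atTop (𝓝 (∫ x, f x ∂μ))} := by
    refine Equicontinuous.isClosed_setOfPred_tendsto
      (F := fun (T : ℝ) (f : C(X, ℂ)) => (T⁻¹ : ℂ) * ∫ t in (0 : ℝ)..T, f (γ t)) ?_ ?_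
    · refine Metric.equicontinuous_of_continuity_modulus id tendsto_id _ fun f g T => ?_
      have hb := intervalIntegral.norm_integral_le_of_norm_le_const (a := 0) (b := T)
        (f := fun t => f (γ t) - g (γ t)) (C := dist f g)
        fun t _ => by rw [← dist_eq_norm]; exact ContinuousMap.dist_apply_le_dist _
      rw [dist_eq_norm, ← mul_sub, ← intervalIntegral.integral_sub (hγint f T) (hγint g T),
        norm_mul, norm_inv, Complex.norm_real, Real.norm_eq_abs]
      rw [sub_zero] at hb
      rcases eq_or_ne T 0 with rfl | hT
      · simp
      · rw [inv_mul_le_iff₀ (abs_pos.2 hT), mul_comm]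
        exact hb
    · refine (LipschitzWith.of_dist_le_mul (K := 1) fun f g => ?_).continuous
      rw [dist_eq_norm, ← integral_sub (hint f) (hint g), NNReal.coe_one, one_mul]
      have hb := norm_integral_le_of_norm_le_const (μ := μ) (f := fun x => f x - g x)
        (C := dist f g) (.of_forall fun x => by
          rw [← dist_eq_norm]; exact ContinuousMap.dist_apply_le_dist _)
      simpa using hb
  have hspan : (span ℂ s : Set C(X, ℂ)) ⊆ {f : C(X, ℂ) | Tendsto (fun T : ℝ => (T⁻¹ : ℂ) *
      ∫ t in (0 : ℝ)..T, f (γ t)) atTop (𝓝 (∫ x, f x ∂μ))} := by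
    intro f hf
    induction hf using Submodule.span_induction with
    | mem f hf => exact h f hf
    | zero => simp
    | add f g _ _ hf hg =>
      simp only [Set.mem_ofPred_eq] at hf hg ⊢
      convert hf.add hg using 1
      · ext T
        simp only [ContinuousMap.add_apply]
        rw [intervalIntegral.integral_add (hγint f T) (hγint g T), mul_add]
      · simp only [ContinuousMap.add_apply]
        rw [integral_add (hint f) (hint g)]
    | smul c f _ hf =>
      simp only [Set.mem_ofPred_eq] at hf ⊢
      convert hf.const_mul c using 1
      · ext T
        simp only [ContinuousMap.smul_apply, smul_eq_mul]
        rw [intervalIntegral.integral_const_mul, mul_left_comm]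
      · simp only [ContinuousMap.smul_apply, smul_eq_mul]
        rw [integral_const_mul]
  exact hclosed.closure_subset_iff.2 hspan (hs f)

section Torus

variable {ι : Type*} [Fintype ι] {p : ℝ}

/-- The monomial `φ ↦ ∏ i, e^(2πi mᵢ φᵢ / p)` on the torus `(ℝ / pℤ)^ι`. -/
noncomputable def torusMonomial (p : ℝ) (m : ι → ℤ) : C(ι → AddCircle p, ℂ) where
  toFun φ := ∏ i, fourier (m i) (φ i)
  continuous_toFun := by fun_prop

theorem dense_span_torusMonomial (hp : p ≠ 0) :
    Dense (span ℂ (Set.range (torusMonomial (ι := ι) p)) : Set C(ι → AddCircle p, ℂ)) := by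
  let e : (ι → AddCircle p) ≃ₜ UnitAddTorus ι :=
    Homeomorph.piCongrRight fun _ => AddCircle.homeomorphAddCircle p 1 hp one_ne_zero
  let L : C(UnitAddTorus ι, ℂ) →ₐ[ℂ] C(ι → AddCircle p, ℂ) :=
    ContinuousMap.compRightAlgHom ℂ ℂ (e : C(ι → AddCircle p, UnitAddTorus ι))
  have hL : Continuous L := ContinuousMap.continuous_precomp _
  have hsurj : Function.Surjective L := fun f =>
    ⟨f.comp (e.symm : C(UnitAddTorus ι, ι → AddCircle p)), by
      ext x
      change f (e.symm (e x)) = f x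
      rw [e.symm_apply_apply]⟩
  have hmon (m : ι → ℤ) : L (UnitAddTorus.mFourier m) = torusMonomial p m := by
    ext x
    change ∏ i, fourier (m i) (AddCircle.homeomorphAddCircle p 1 hp one_ne_zero (x i)) =
      ∏ i, fourier (m i) (x i)
    refine Finset.prod_congr rfl fun i _ => ?_
    induction x i using QuotientAddGroup.induction_on with
    | H y =>
      rw [AddCircle.homeomorphAddCircle_apply_mk, fourier_coe_apply, fourier_coe_apply]
      congr 1
      push_cast
      ring
  have hdense : Dense (span ℂ (Set.range (UnitAddTorus.mFourier (d := ι))) :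
      Set C(UnitAddTorus ι, ℂ)) :=
    (Submodule.dense_iff_topologicalClosure_eq_top).2 UnitAddTorus.span_mFourier_closure_eq_top
  have hmap : (span ℂ (Set.range (torusMonomial (ι := ι) p)) : Set C(ι → AddCircle p, ℂ)) =
      L '' (span ℂ (Set.range (UnitAddTorus.mFourier (d := ι)))) := by
    change _ = L.toLinearMap '' _
    rw [← Submodule.map_coe, Submodule.map_span, ← Set.range_comp]
    congr 3
    ext1 m
    exact (hmon m).symm
  rw [hmap]
  exact hsurj.denseRange.dense_image hL hdense

theorem integral_fourier_haarAddCircle [Fact (0 < p)] (n : ℤ) :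
    ∫ x : AddCircle p, fourier n x ∂AddCircle.haarAddCircle = if n = 0 then 1 else 0 := by
  split_ifs with h
  · simp [h]
  · exact integral_eq_zero_of_add_right_eq_neg (fourier_add_half_inv_index h Fact.out)

theorem integral_torusMonomial [Fact (0 < p)] (m : ι → ℤ) :
    ∫ φ, torusMonomial p m φ ∂(Measure.pi fun _ => AddCircle.haarAddCircle) =
      if m = 0 then 1 else 0 := by
  change ∫ φ : ι → AddCircle p, ∏ i, fourier (m i) (φ i) ∂_ = _
  rw [integral_fintype_prod_eq_prod]
  simp_rw [integral_fourier_haarAddCircle, funext_iff, Pi.zero_apply]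
  rw [Finset.prod_ite_zero]
  simp

/-- **Weyl's equidistribution theorem** for nonresonant linear windings of the torus. -/
theorem tendsto_timeAverage_torus [Fact (0 < p)] {ω : ι → ℝ}
    (hω : ∀ m : ι → ℤ, ∑ i, (m i : ℝ) * ω i = 0 → m = 0) (a : ι → ℝ)
    (f : C(ι → AddCircle p, ℂ)) :
    Tendsto (fun T : ℝ => (T⁻¹ : ℂ) *
        ∫ t in (0 : ℝ)..T, f fun i => ((ω i * t + a i : ℝ) : AddCircle p)) atTop
      (𝓝 (∫ φ, f φ ∂(Measure.pi fun _ => AddCircle.haarAddCircle))) := by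
  have hp : p ≠ 0 := (Fact.out : 0 < p).ne'
  refine tendsto_timeAverage_of_span_dense
    (γ := fun t i => ((ω i * t + a i : ℝ) : AddCircle p)) ?_ (dense_span_torusMonomial hp) ?_ f
  · exact continuous_pi fun i => (AddCircle.continuous_mk' p).comp (by fun_prop)
  rintro _ ⟨m, rfl⟩
  rw [integral_torusMonomial]
  split_ifs with hm
  · subst hm
    refine tendsto_const_nhds.congr' ?_
    filter_upwards [eventually_ne_atTop 0] with T hT
    simp [torusMonomial, hT]
  set c : ℂ := ((2 * π / p * ∑ i, (m i : ℝ) * ω i : ℝ) : ℂ) * Complex.I with hc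
  set d : ℂ := ((2 * π / p * ∑ i, (m i : ℝ) * a i : ℝ) : ℂ) * Complex.I with hd
  have hc0 : c ≠ 0 := by
    refine mul_ne_zero (Complex.ofReal_ne_zero.2 (mul_ne_zero ?_ (mt (hω m) hm))) Complex.I_ne_zero
    positivity
  have hval (t : ℝ) : torusMonomial p m (fun i => ((ω i * t + a i : ℝ) : AddCircle p)) =
      Complex.exp (c * t) * Complex.exp d := by
    change ∏ i, fourier (m i) ((ω i * t + a i : ℝ) : AddCircle p) = _
    simp_rw [fourier_coe_apply]
    rw [← Complex.exp_sum, ← Complex.exp_add, hc, hd]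
    congr 1
    push_cast
    simp only [Finset.mul_sum, Finset.sum_mul, ← Finset.sum_add_distrib]
    refine Finset.sum_congr rfl fun i _ => ?_
    ring
  simp_rw [hval, intervalIntegral.integral_mul_const, integral_exp_mul_complex hc0]
  have hbound : ∀ᶠ T : ℝ in atTop, ‖(Complex.exp (c * T) - Complex.exp (c * (0 : ℝ))) / c *
      Complex.exp d‖ ≤ 2 / ‖c‖ := by
    refine .of_forall fun T => ?_
    have he : ‖Complex.exp (c * T)‖ = 1 := by
      rw [hc, mul_right_comm, ← Complex.ofReal_mul, Complex.norm_exp_ofReal_mul_I]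
    rw [norm_mul, norm_div, hd, Complex.norm_exp_ofReal_mul_I, mul_one]
    gcongr
    refine (norm_sub_le _ _).trans ?_
    rw [he]
    norm_num
  have hinv : Tendsto (fun T : ℝ => ((T : ℂ))⁻¹) atTop (𝓝 0) := by
    simpa [Function.comp_def] using
      (Complex.continuous_ofReal.tendsto 0).comp tendsto_inv_atTop_zero
  exact hinv.zero_mul_isBoundedUnder_le (isBoundedUnder_of_eventually_le hbound)

end Torus

theorem exists_mul_cos_add_mul_sin_eq (a b : ℝ) :
    ∃ α : ℝ, ∀ θ : ℝ, a * cos θ + b * sin θ = √(a ^ 2 + b ^ 2) * cos (θ + α) := by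
  refine ⟨-(⟨a, b⟩ : ℂ).arg, fun θ => ?_⟩
  have hr : √(a ^ 2 + b ^ 2) = ‖(⟨a, b⟩ : ℂ)‖ := by rw [Complex.norm_eq_sqrt_sq_add_sq]
  have hcos := Complex.norm_mul_cos_arg ⟨a, b⟩
  have hsin := Complex.norm_mul_sin_arg ⟨a, b⟩
  rw [← sub_eq_add_neg, cos_sub, hr]
  linear_combination (-cos θ) * hcos - sin θ * hsin

/-- For a system of `N` harmonic oscillators with nonresonant frequencies `ω i`
(no nontrivial integer relation `∑ mᵢ ωᵢ = 0`), the support function of the reachable set,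
`H_{D(T)}(p) = ∫₀ᵀ |∑ i, ηᵢ cos ωᵢt + ωᵢ⁻¹ ξᵢ sin ωᵢt| dt`, satisfies
`lim_{T→∞} (1/T) H_{D(T)}(p) = ∫_𝕋 |∑ i, zᵢ cos φᵢ| dφ` with respect to normalized Haar
measure on the `N`-torus, where `zᵢ = (ηᵢ² + ωᵢ⁻² ξᵢ²)^{1/2}`. -/
theorem oscillators_support_function_asymptotics
    (N : ℕ) (ω : Fin N → ℝ) (hω : ∀ i, 0 < ω i)
    (hres : ∀ m : Fin N → ℤ, (∑ i, (m i : ℝ) * ω i) = 0 → m = 0)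
    (ξ η : Fin N → ℝ) (z : Fin N → ℝ)
    (hz : ∀ i, z i = Real.sqrt ((η i) ^ 2 + ((ω i)⁻¹) ^ 2 * (ξ i) ^ 2)) :
    Tendsto (fun T : ℝ => (1 / T) *
        ∫ t in (0:ℝ)..T,
          |∑ i, (η i * Real.cos (ω i * t) + (ω i)⁻¹ * ξ i * Real.sin (ω i * t))|)
      atTop
      (nhds (∫ φ : Fin N → Real.Angle, |∑ i, z i * (φ i).cos|
        ∂(Measure.pi fun _ => AddCircle.haarAddCircle))) := by
  choose α hα using fun i => exists_mul_cos_add_mul_sin_eq (η i) ((ω i)⁻¹ * ξ i)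
  have hcont : Continuous fun φ : Fin N → AddCircle (2 * π) =>
      ((|∑ i, z i * Real.Angle.cos (φ i)| : ℝ) : ℂ) :=
    Complex.continuous_ofReal.comp <| continuous_abs.comp <| continuous_finsetSum _ fun i _ =>
      continuous_const.mul <| Real.Angle.continuous_cos.comp (continuous_apply i)
  have key := (Complex.continuous_re.tendsto _).comp
    (tendsto_timeAverage_torus (p := 2 * π) hres α ⟨_, hcont⟩)
  convert key using 1
  · ext T
    have hval (t : ℝ) : ∑ i, (η i * cos (ω i * t) + (ω i)⁻¹ * ξ i * sin (ω i * t)) =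
        ∑ i, z i * Real.Angle.cos ((ω i * t + α i : ℝ) : Real.Angle) :=
      Finset.sum_congr rfl fun i _ => by rw [hα, hz, Real.Angle.cos_coe, mul_pow]
    simp_rw [hval]
    change _ = ((T : ℂ)⁻¹ * ∫ t in (0 : ℝ)..T,
      ((|∑ i, z i * Real.Angle.cos ((ω i * t + α i : ℝ) : Real.Angle)| : ℝ) : ℂ)).re
    rw [intervalIntegral.integral_ofReal, ← Complex.ofReal_inv, ← Complex.ofReal_mul,
      Complex.ofReal_re, one_div]
  · congr 1
    change _ = (∫ φ : Fin N → AddCircle (2 * π), ((|∑ i, z i * Real.Angle.cos (φ i)| : ℝ) : ℂ)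
      ∂(Measure.pi fun _ => AddCircle.haarAddCircle)).re
    rw [integral_complex_ofReal, Complex.ofReal_re]
    rfl
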